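/- Let s ∈ (1/2, 1] and let φ : ℝ → ℂ be a C^∞ function with support contained in [1/2,2]. There exists a constant C, depending only on φ and s, such that for all coprime integers p, q with q ≥ 1, all integers N ≥ q and all 0 < h ≤ 1/q: |F^φ_{s,N}(p/q + h) − (N^{1−s} θ_0/√q) ∫_ℝ t^{−s} e^{2πi N² h t²} φ(t) dt − G^φ_{s,N}(h)| ≤ C q N^{−1/2−s}, where G^φ_{s,N}(h) = (2hq)^{s−1/2} e^{iπ/4} Σ_{m≥1} (θ_m/m^s) e^{−iπ m²/(2 q² h)} φ(m/(2Nhq)). -/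

import Mathlib

open MeasureTheory Filter Set
open scoped Real BigOperators ENNReal

/-- The Gauss sum `τ_m = ∑_{b=0}^{q-1} e^{2πi (p b² + m b)/q}`. -/
noncomputable def gaussTau (p : ℤ) (q : ℕ) (m : ℤ) : ℂ :=
  ∑ b ∈ Finset.range q,
    Complex.exp (2 * Real.pi * Complex.I * ((p : ℂ) * (b : ℂ) ^ 2 + (m : ℂ) * (b : ℂ)) / (q : ℂ))

/-- `θ_m = τ_m / √q`. -/
noncomputable def gaussTheta (p : ℤ) (q : ℕ) (m : ℤ) : ℂ :=
  gaussTau p q m / (Real.sqrt q : ℂ)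

/-- `F^φ_{s,N}(x) = ∑_{n ≥ 1} n^{-s} e^{2πi n² x} φ(n/N)`. -/
noncomputable def FphiN (s : ℝ) (φ : ℝ → ℂ) (N : ℕ) (x : ℝ) : ℂ :=
  ∑' n : ℕ, (((((n : ℝ) + 1) ^ (-s) : ℝ)) : ℂ) *
    Complex.exp (2 * Real.pi * Complex.I * ((n : ℂ) + 1) ^ 2 * (x : ℂ)) *
    φ (((n : ℝ) + 1) / N)

/-- `G^φ_{s,N}(h) = (2hq)^{s-1/2} e^{iπ/4} ∑_{m ≥ 1} (θ_m/m^s) e^{-iπm²/(2q²h)} φ(m/(2Nhq))`. -/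
noncomputable def GphiN (s : ℝ) (φ : ℝ → ℂ) (p : ℤ) (q : ℕ) (N : ℕ) (h : ℝ) : ℂ :=
  (((2 * h * q) ^ (s - 1/2) : ℝ) : ℂ) * Complex.exp (Complex.I * Real.pi / 4) *
    ∑' m : ℕ, gaussTheta p q (m + 1) * (((((m : ℝ) + 1) ^ (-s) : ℝ)) : ℂ) *
      Complex.exp (-(Complex.I * Real.pi * ((m : ℂ) + 1) ^ 2 / (2 * (q : ℂ) ^ 2 * (h : ℂ)))) *
      φ (((m : ℝ) + 1) / (2 * N * h * q))


lemma card_two_mul_eq_zero (q : ℕ) [NeZero q] :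
    (Finset.univ.filter (fun d : ZMod q => 2 * d = 0)).card ≤ 2 := by
  have hsub : (Finset.univ.filter (fun d : ZMod q => 2 * d = 0)) ⊆
      {(0 : ZMod q), ((q / 2 : ℕ) : ZMod q)} := by
    intro d hd
    simp only [Finset.mem_filter, Finset.mem_univ, true_and] at hd
    have h1 : ((2 * d.val : ℕ) : ZMod q) = 0 := by
      push_cast
      rw [ZMod.natCast_zmod_val]; exact hd
    rw [ZMod.natCast_eq_zero_iff] at h1
    have h2 := ZMod.val_lt d
    obtain ⟨k, hk⟩ := h1
    have hk2 : k < 2 := by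
      by_contra hcon
      push Not at hcon
      nlinarith
    simp only [Finset.mem_insert, Finset.mem_singleton]
    interval_cases k
    · left
      have : d.val = 0 := by omega
      exact (ZMod.val_eq_zero d).1 this
    · right
      have : q / 2 = d.val := by omega
      rw [this, ZMod.natCast_zmod_val]
  exact (Finset.card_le_card hsub).trans Finset.card_le_two

lemma gaussTau_eq (p : ℤ) (q : ℕ) [NeZero q] (m : ℤ) :
    gaussTau p q m = ∑ x : ZMod q, ZMod.stdAddChar ((p : ZMod q) * x ^ 2 + (m : ZMod q) * x) := by
  unfold gaussTau
  have : ∀ b ∈ Finset.range q,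
      Complex.exp (2 * Real.pi * Complex.I * ((p : ℂ) * (b : ℂ) ^ 2 + (m : ℂ) * (b : ℂ)) / (q : ℂ))
      = ZMod.stdAddChar ((p : ZMod q) * (b : ZMod q) ^ 2 + (m : ZMod q) * (b : ZMod q)) := by
    intro b _
    have := ZMod.stdAddChar_coe (N := q) (p * (b:ℤ) ^ 2 + m * (b : ℤ))
    push_cast at this
    rw [this]
  rw [Finset.sum_congr rfl this]
  symm
  refine Finset.sum_bij (fun x _ => x.val) ?_ ?_ ?_ ?_
  · intro a _; exact Finset.mem_range.2 (ZMod.val_lt a)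
  · intro a _ b _ h; exact ZMod.val_injective q h
  · intro b hb; exact ⟨(b : ZMod q), Finset.mem_univ _, ZMod.val_cast_of_lt (Finset.mem_range.1 hb)⟩
  · intro a _; simp

lemma gaussTau_norm_sq_le (p : ℤ) (q : ℕ) (hq : 1 ≤ q) (hpq : IsCoprime p (q : ℤ)) (m : ℤ) :
    ‖gaussTau p q m‖ ^ 2 ≤ 2 * q := by
  have : NeZero q := ⟨by omega⟩
  have hpu : IsUnit (p : ZMod q) := by
    obtain ⟨a, b, hab⟩ := hpq
    have h1 : ((a * p + b * (q:ℤ) : ℤ) : ZMod q) = 1 := by rw [hab]; simp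
    push_cast at h1
    rw [ZMod.natCast_self, mul_zero, add_zero] at h1
    exact IsUnit.of_mul_eq_one_right _ h1
  set ψ : AddChar (ZMod q) ℂ := ZMod.stdAddChar with hψ
  set Q : ZMod q → ZMod q := fun x => (p : ZMod q) * x ^ 2 + (m : ZMod q) * x with hQ
  have hconj : ∀ x, (starRingEnd ℂ) (ψ x) = ψ (-x) := by
    intro x
    rw [AddChar.map_neg_eq_conj]
  have hn : ∀ x, ‖ψ x‖ = 1 := fun x => AddChar.norm_apply ψ x
  have key : ((‖gaussTau p q m‖ ^ 2 : ℝ) : ℂ) =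
      ∑ d : ZMod q, ψ (Q d) * (if 2 * d = 0 then (q : ℂ) else 0) := by
    have e1 : ((‖gaussTau p q m‖ ^ 2 : ℝ) : ℂ) = gaussTau p q m * (starRingEnd ℂ) (gaussTau p q m) := by
      rw [Complex.mul_conj, Complex.normSq_eq_norm_sq]
    rw [e1, gaussTau_eq, map_sum, Finset.sum_mul_sum, Finset.sum_comm]
    have e2 : ∀ y : ZMod q, ∑ x : ZMod q, ψ (Q x) * (starRingEnd ℂ) (ψ (Q y)) =
        ∑ d : ZMod q, ψ (Q d) * ψ (y * (2 * p * d)) := by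
      intro y
      rw [← Equiv.sum_comp (Equiv.addRight y)]
      refine Finset.sum_congr rfl fun d _ => ?_
      rw [hconj, ← AddChar.map_add_eq_mul, ← AddChar.map_add_eq_mul]
      congr 1
      simp only [hQ, Equiv.coe_addRight]
      ring
    rw [Finset.sum_congr rfl fun y _ => e2 y, Finset.sum_comm]
    refine Finset.sum_congr rfl fun d _ => ?_
    rw [← Finset.mul_sum, AddChar.sum_mulShift _ (ZMod.isPrimitive_stdAddChar q)]
    have : (2 * (p : ZMod q) * d = 0) ↔ 2 * d = 0 := by
      rw [show 2 * (p : ZMod q) * d = p * (2 * d) by ring]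
      exact hpu.mul_right_eq_zero
    simp only [this, ZMod.card]
    split_ifs <;> simp
  have h1 : ‖gaussTau p q m‖ ^ 2 = ‖((‖gaussTau p q m‖ ^ 2 : ℝ) : ℂ)‖ := by
    rw [Complex.norm_real, Real.norm_of_nonneg (by positivity)]
  rw [h1, key]
  calc _ ≤ ∑ d : ZMod q, ‖ψ (Q d) * (if 2 * d = 0 then (q : ℂ) else 0)‖ := norm_sum_le _ _
    _ = ∑ d : ZMod q, (if 2 * d = 0 then (q : ℝ) else 0) := by
        refine Finset.sum_congr rfl fun d _ => ?_
        rw [norm_mul, hn, one_mul]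
        split_ifs <;> simp
    _ = (Finset.univ.filter (fun d : ZMod q => 2 * d = 0)).card * (q : ℝ) := by
        rw [← Finset.sum_filter, Finset.sum_const, nsmul_eq_mul]
    _ ≤ 2 * q := by
        gcongr
        exact_mod_cast card_two_mul_eq_zero q

lemma gaussTau_norm_le (p : ℤ) (q : ℕ) (hq : 1 ≤ q) (hpq : IsCoprime p (q : ℤ)) (m : ℤ) :
    ‖gaussTau p q m‖ ≤ 2 * Real.sqrt q := by
  have h := gaussTau_norm_sq_le p q hq hpq m
  have h2 : Real.sqrt q ^ 2 = q := Real.sq_sqrt (by positivity)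
  refine abs_le_of_sq_le_sq' ?_ (by positivity) |>.2
  nlinarith [Nat.cast_nonneg (α := ℝ) q]

lemma norm_exp_sub_one_le_two_mul {z : ℂ} (hz : z.re ≤ 0) : ‖Complex.exp z - 1‖ ≤ 2 * ‖z‖ := by
  by_cases h : ‖z‖ ≤ 1
  · exact Complex.norm_exp_sub_one_le h
  · push Not at h
    have h1 : ‖Complex.exp z‖ ≤ 1 := by
      rw [Complex.norm_exp]; exact Real.exp_le_one_iff.2 hz
    calc ‖Complex.exp z - 1‖ ≤ ‖Complex.exp z‖ + ‖(1:ℂ)‖ := norm_sub_le _ _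
      _ ≤ 2 * ‖z‖ := by simp; linarith

open scoped SchwartzMap FourierTransform in
lemma stat_complex (f : 𝓢(ℝ, ℂ)) : ∃ C : ℝ, 0 ≤ C ∧ ∀ β : ℂ, 0 < β.re → ∀ t0 : ℝ,
    ‖(∫ t : ℝ, f t * Complex.exp (-π / β * ((t : ℂ) - t0) ^ 2)) - β ^ (1/2 : ℂ) * f t0‖
      ≤ C * ‖β‖ ^ (3/2 : ℝ) := by
  refine ⟨∫ ξ : ℝ, 2 * π * (‖ξ‖ ^ 2 * ‖(𝓕 f) ξ‖), integral_nonneg fun ξ => by positivity, ?_⟩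
  intro β hβ t0
  have hβ0 : β ≠ 0 := by rintro rfl; simp at hβ
  have hroot : β ^ (1/2 : ℂ) ≠ 0 := by
    rw [Ne, Complex.cpow_eq_zero_iff]; simp [hβ0]
  set g : ℝ → ℂ := fun x => Complex.exp (-π * β * x ^ 2 + 2 * π * (Complex.I * t0) * x) with hg
  have hgF : 𝓕 g = fun t : ℝ => 1 / β ^ (1/2 : ℂ) *
      Complex.exp (-π / β * (t + Complex.I * (Complex.I * t0)) ^ 2) :=
    fourier_gaussian_pi' hβ (Complex.I * t0)
  have hgi : Integrable g := by
    have h2 := integrable_cexp_quadratic (b := π * β)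
      (by simpa using mul_pos Real.pi_pos hβ) (2 * π * (Complex.I * t0)) 0
    simpa [hg] using h2
  have hflip : ∫ ξ : ℝ, (𝓕 f) ξ * g ξ = ∫ x : ℝ, f x * (𝓕 g) x := by
    have := VectorFourier.integral_fourierIntegral_smul_eq_flip (L := innerₗ ℝ)
      Real.continuous_fourierChar continuous_inner (f.integrable (μ := volume)) hgi
    simpa [SchwartzMap.fourier_coe] using! this
  have h1 : ∫ t : ℝ, f t * Complex.exp (-π / β * ((t : ℂ) - t0) ^ 2) =
      β ^ (1/2 : ℂ) * ∫ ξ : ℝ, (𝓕 f) ξ * g ξ := by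
    rw [hflip, hgF, ← integral_const_mul]
    congr 1
    ext t
    have : (t : ℂ) + Complex.I * (Complex.I * t0) = t - t0 := by
      rw [← mul_assoc, Complex.I_mul_I]; ring
    simp only [this]
    field_simp
  have h2 : f t0 = ∫ ξ : ℝ, (𝓕 f) ξ * Complex.exp (2 * π * (Complex.I * t0) * ξ) := by
    have := congrArg (fun F : 𝓢(ℝ, ℂ) => F t0) (FourierTransform.fourierInv_fourier_eq (F := 𝓢(ℝ, ℂ)) f)
    rw [← this]
    simp only [SchwartzMap.fourierInv_coe]
    rw [Real.fourierInv_eq']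
    congr 1
    ext ξ
    rw [smul_eq_mul, mul_comm]
    congr 2
    simp
    ring
  have hi1 : Integrable (fun ξ : ℝ => (𝓕 f) ξ * Complex.exp (2 * π * (Complex.I * t0) * ξ)) := by
    refine (𝓕 f).integrable.mul_bdd (c := 1) (by fun_prop) (Eventually.of_forall fun ξ => ?_)
    rw [Complex.norm_exp]; simp
  have hi2 : Integrable (fun ξ : ℝ => (𝓕 f) ξ * g ξ) := by
    refine (𝓕 f).integrable.mul_bdd (c := 1) (by fun_prop) (Eventually.of_forall fun ξ => ?_)
    rw [hg, Complex.norm_exp]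
    refine Real.exp_le_one_iff.2 ?_
    rw [← Complex.ofReal_pow, Complex.add_re, Complex.re_mul_ofReal, ← Complex.ofReal_neg,
      Complex.re_ofReal_mul]
    have : 0 ≤ π * β.re * ξ ^ 2 := by positivity
    simp
    linarith
  rw [h1, ← mul_sub, norm_mul]
  have h3 : ‖β ^ (1/2 : ℂ)‖ = ‖β‖ ^ (1/2 : ℝ) := by
    have := Complex.norm_cpow_real β (1/2)
    push_cast at this
    exact this
  have h4 : ‖(∫ ξ : ℝ, (𝓕 f) ξ * g ξ) - f t0‖ ≤
      (∫ ξ : ℝ, 2 * π * (‖ξ‖ ^ 2 * ‖(𝓕 f) ξ‖)) * ‖β‖ := by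
    rw [h2, ← integral_sub hi2 hi1, ← integral_mul_const]
    refine norm_integral_le_of_norm_le ?_ (Eventually.of_forall fun ξ => ?_)
    · exact (((𝓕 f).integrable_pow_mul volume 2).const_mul _).mul_const _
    · have e1 : g ξ = Complex.exp (-π * β * ξ ^ 2) * Complex.exp (2 * π * (Complex.I * t0) * ξ) := by
        rw [hg, ← Complex.exp_add]
      have e2 : (𝓕 f) ξ * g ξ - (𝓕 f) ξ * Complex.exp (2 * π * (Complex.I * t0) * ξ) =
        (𝓕 f) ξ * Complex.exp (2 * π * (Complex.I * t0) * ξ) * (Complex.exp (-π * β * ξ ^ 2) - 1) := by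
        rw [e1]; ring
      have e3 : ‖Complex.exp (2 * π * (Complex.I * t0) * ξ)‖ = 1 := by
        rw [Complex.norm_exp]; simp
      have e4 : ‖Complex.exp (-π * β * ξ ^ 2) - 1‖ ≤ 2 * ‖-π * β * (ξ:ℂ) ^ 2‖ := by
        refine norm_exp_sub_one_le_two_mul ?_
        rw [← Complex.ofReal_pow, Complex.re_mul_ofReal, ← Complex.ofReal_neg, Complex.re_ofReal_mul]
        have : 0 ≤ π * β.re * ξ ^ 2 := by positivity
        linarith
      have e5 : ‖-π * β * (ξ:ℂ) ^ 2‖ = π * ‖β‖ * ‖ξ‖ ^ 2 := by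
        simp [abs_of_pos Real.pi_pos]
      rw [e2, norm_mul, norm_mul, e3, mul_one]
      rw [e5] at e4
      calc _ ≤ ‖(𝓕 f) ξ‖ * (2 * (π * ‖β‖ * ‖ξ‖ ^ 2)) := by gcongr
        _ = _ := by ring
  have h5 : ‖β‖ ^ (3/2 : ℝ) = ‖β‖ ^ (1/2 : ℝ) * ‖β‖ := by
    have : 0 < ‖β‖ := norm_pos_iff.2 hβ0
    rw [show (3/2 : ℝ) = 1/2 + 1 by norm_num, Real.rpow_add this, Real.rpow_one]
  rw [h3, h5]
  calc _ ≤ ‖β‖ ^ (1/2 : ℝ) * ((∫ ξ : ℝ, 2 * π * (‖ξ‖ ^ 2 * ‖(𝓕 f) ξ‖)) * ‖β‖) := by gcongr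
    _ = _ := by ring

open scoped SchwartzMap FourierTransform in
lemma stat_real (f : 𝓢(ℝ, ℂ)) : ∃ C : ℝ, 0 ≤ C ∧ ∀ l : ℝ, 0 < l → ∀ t0 : ℝ,
    ‖(∫ t : ℝ, f t * Complex.exp (2 * π * Complex.I * l * ((t : ℂ) - t0) ^ 2)) -
      (((2 * l) ^ (-(1/2) : ℝ) : ℝ) : ℂ) * Complex.exp (Complex.I * π / 4) * f t0‖
      ≤ C * (2 * l) ^ (-(3/2) : ℝ) := by
  obtain ⟨C, hC, H⟩ := stat_complex f
  refine ⟨C, hC, ?_⟩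
  intro l hl t0
  set β : ℝ → ℂ := fun δ => (δ : ℂ) + Complex.I * ((2 * l)⁻¹ : ℝ) with hβ
  have hβre : ∀ δ, (β δ).re = δ := by intro δ; simp [hβ]
  have hβim : ∀ δ, (β δ).im = (2 * l)⁻¹ := by intro δ; simp [hβ]
  have hβne : ∀ δ, β δ ≠ 0 := by
    intro δ h
    have := hβim δ
    rw [h] at this
    simp at this
    linarith
  have hcont : Continuous β := by fun_prop
  have hβ0 : β 0 = Complex.I * ((2 * l)⁻¹ : ℝ) := by simp [hβ]
  have hTl : Tendsto β (nhdsWithin 0 (Ioi 0)) (nhds (β 0)) :=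
    (hcont.tendsto 0).mono_left nhdsWithin_le_nhds
  have hslit : β 0 ∈ Complex.slitPlane := by
    right; rw [hβim]; positivity
  have hroot0 : β 0 ^ (1/2 : ℂ) = (((2 * l) ^ (-(1/2) : ℝ) : ℝ) : ℂ) * Complex.exp (Complex.I * π / 4) := by
    have hp : 0 < (2 * l)⁻¹ := by positivity
    rw [Complex.cpow_def_of_ne_zero (hβne 0), hβ0, mul_comm Complex.I,
      Complex.log_ofReal_mul hp Complex.I_ne_zero, Complex.log_I, Real.log_inv,
      Real.rpow_def_of_pos (by positivity), Complex.ofReal_exp, ← Complex.exp_add]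
    congr 1
    push_cast
    ring
  have hnorm0 : ‖β 0‖ ^ (3/2 : ℝ) = (2 * l) ^ (-(3/2) : ℝ) := by
    rw [hβ0, norm_mul, Complex.norm_I, one_mul, Complex.norm_real,
      Real.norm_of_nonneg (by positivity), Real.inv_rpow (by positivity), Real.rpow_neg (by positivity)]
  have hint : Tendsto (fun δ => ∫ t : ℝ, f t * Complex.exp (-π / β δ * ((t : ℂ) - t0) ^ 2))
      (nhdsWithin 0 (Ioi 0)) (nhds (∫ t : ℝ, f t * Complex.exp (-π / β 0 * ((t : ℂ) - t0) ^ 2))) := by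
    refine tendsto_integral_filter_of_dominated_convergence (fun t => ‖f t‖) ?_ ?_ f.integrable.norm ?_
    · exact Eventually.of_forall fun δ => by
        refine Continuous.aestronglyMeasurable ?_
        exact f.continuous.mul (by fun_prop)
    · filter_upwards [self_mem_nhdsWithin] with δ hδ
      refine Eventually.of_forall fun t => ?_
      rw [norm_mul]
      refine mul_le_of_le_one_right (norm_nonneg _) ?_
      rw [Complex.norm_exp]
      refine Real.exp_le_one_iff.2 ?_
      rw [← Complex.ofReal_sub, ← Complex.ofReal_pow, Complex.re_mul_ofReal]
      refine mul_nonpos_of_nonpos_of_nonneg ?_ (sq_nonneg _)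
      have hδ' : 0 < δ := hδ
      rw [neg_div, Complex.neg_re, Complex.div_re, hβre]
      simp only [Complex.ofReal_re, Complex.ofReal_im, zero_mul, zero_div, add_zero]
      have : 0 ≤ π * δ / Complex.normSq (β δ) :=
        div_nonneg (by positivity) (Complex.normSq_nonneg _)
      linarith
    · refine Eventually.of_forall fun t => ?_
      refine Tendsto.mul tendsto_const_nhds ?_
      refine (Complex.continuous_exp.tendsto _).comp ?_
      exact (tendsto_const_nhds.div hTl (hβne 0)).mul tendsto_const_nhds
  have hconv : (∫ t : ℝ, f t * Complex.exp (2 * π * Complex.I * l * ((t : ℂ) - t0) ^ 2)) =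
      ∫ t : ℝ, f t * Complex.exp (-π / β 0 * ((t : ℂ) - t0) ^ 2) := by
    congr 1
    ext t
    congr 3
    rw [hβ0]
    have : (l : ℂ) ≠ 0 := by exact_mod_cast hl.ne'
    push_cast
    field_simp
    rw [Complex.I_sq]
  rw [hconv, ← hroot0, ← hnorm0]
  refine le_of_tendsto_of_tendsto ((hint.sub (Tendsto.mul ?_ tendsto_const_nhds)).norm)
    (tendsto_const_nhds.mul ?_) ?_ (b := nhdsWithin (0:ℝ) (Ioi 0))
    (f := fun δ => ‖(∫ t : ℝ, f t * Complex.exp (-π / β δ * ((t : ℂ) - t0) ^ 2)) - β δ ^ (1/2 : ℂ) * f t0‖)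
    (g := fun δ => C * ‖β δ‖ ^ (3/2 : ℝ))
  · exact ((continuousAt_cpow_const hslit).tendsto).comp hTl
  · exact (hTl.norm).rpow_const (Or.inr (by norm_num))
  · filter_upwards [self_mem_nhdsWithin] with δ hδ
    exact H (β δ) (by rw [hβre]; exact hδ) t0

lemma nonstat (a : ℝ → ℂ) (ha : ContDiff ℝ (⊤ : ℕ∞) a) (hsupp : tsupport a ⊆ Set.Icc (1/2 : ℝ) 2) :
    ∃ K : ℝ, 0 ≤ K ∧ ∀ l : ℝ, 0 < l → ∀ t0 : ℝ, t0 ≠ 0 → t0 ∉ Set.Icc (1/4 : ℝ) 4 →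
    ‖∫ t : ℝ, a t * Complex.exp (2 * π * Complex.I * l * ((t : ℂ) - t0) ^ 2)‖
      ≤ K * ((l * t0) ^ 2)⁻¹ := by
  have hcs : HasCompactSupport a := HasCompactSupport.of_support_subset_isCompact isCompact_Icc
    ((subset_tsupport a).trans hsupp)
  set a1 := deriv a with ha1
  set a2 := deriv a1 with ha2
  have hc1 : ContDiff ℝ (⊤ : ℕ∞) a1 := by
    have := (contDiff_infty_iff_deriv (f := a)).1 ha
    exact this.2
  have hc2 : ContDiff ℝ (⊤ : ℕ∞) a2 := by
    have := (contDiff_infty_iff_deriv (f := a1)).1 hc1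
    exact this.2
  have hd0 : ∀ t, HasDerivAt a (a1 t) t := fun t =>
    ((ha.differentiable (by simp)) t).hasDerivAt
  have hd1 : ∀ t, HasDerivAt a1 (a2 t) t := fun t =>
    ((hc1.differentiable (by simp)) t).hasDerivAt
  obtain ⟨B0, hB0⟩ := hcs.exists_bound_of_continuous ha.continuous
  obtain ⟨B1, hB1⟩ := hcs.deriv.exists_bound_of_continuous hc1.continuous
  obtain ⟨B2, hB2⟩ := hcs.deriv.deriv.exists_bound_of_continuous hc2.continuous
  set B := max B0 (max B1 B2) with hB
  have hb0 : ∀ t, ‖a t‖ ≤ B := fun t => (hB0 t).trans (le_max_left _ _)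
  have hb1 : ∀ t, ‖a1 t‖ ≤ B := fun t => (hB1 t).trans ((le_max_left _ _).trans (le_max_right _ _))
  have hb2 : ∀ t, ‖a2 t‖ ≤ B := fun t => (hB2 t).trans ((le_max_right _ _).trans (le_max_right _ _))
  have hBn : 0 ≤ B := (norm_nonneg _).trans (hb0 0)
  have hz0 : ∀ t, t ∉ Set.Icc (1/2 : ℝ) 2 → a t = 0 := fun t ht =>
    image_eq_zero_of_notMem_tsupport fun h => ht (hsupp h)
  have hz1 : ∀ t, t ∉ Set.Icc (1/2 : ℝ) 2 → a1 t = 0 := fun t ht =>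
    image_eq_zero_of_notMem_tsupport fun h => ht (hsupp (tsupport_deriv_subset (𝕜 := ℝ) h))
  refine ⟨217 * 16 * 3 * B, by positivity, ?_⟩
  intro l hl t0 ht0 hout
  set α : ℂ := (4 * π * Complex.I * l)⁻¹ with hα
  have hlC : (l : ℂ) ≠ 0 := by exact_mod_cast hl.ne'
  have hpC : (π : ℂ) ≠ 0 := by exact_mod_cast Real.pi_ne_zero
  have hα0 : α ≠ 0 := by
    rw [hα]; simp [hlC, hpC]
  have hαn : ‖α‖ ≤ l⁻¹ := by
    rw [hα, norm_inv]
    refine inv_anti₀ hl ?_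
    simp [abs_of_pos Real.pi_pos, abs_of_pos hl]
    nlinarith [Real.pi_gt_three]
  have hu : ∀ t ∈ Set.Icc (3/8 : ℝ) 3, 1/8 ≤ |t - t0| ∧ |t0| / 4 ≤ |t - t0| := by
    intro t ht
    obtain ⟨h1, h2⟩ := ht
    rw [Set.mem_Icc, not_and_or] at hout
    rcases hout with h | h
    · push Not at h
      rw [abs_of_pos (by linarith : 0 < t - t0)]
      refine ⟨by linarith, ?_⟩
      rcases abs_cases t0 with ⟨h3, _⟩ | ⟨h3, _⟩ <;> rw [h3] <;> linarith
    · push Not at h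
      rw [abs_of_neg (by linarith : t - t0 < 0), abs_of_pos (by linarith : 0 < t0)]
      constructor <;> linarith
  have hune : ∀ t ∈ Set.Icc (3/8 : ℝ) 3, ((t : ℂ) - t0) ≠ 0 := by
    intro t ht h
    have := (hu t ht).1
    rw [← Complex.ofReal_sub, Complex.ofReal_eq_zero] at h
    rw [h] at this
    norm_num at this
  set E : ℝ → ℂ := fun t => Complex.exp (2 * π * Complex.I * l * ((t : ℂ) - t0) ^ 2) with hE
  have hEn : ∀ t, ‖E t‖ = 1 := by
    intro t
    rw [hE]
    simp only
    rw [Complex.norm_exp, ← Complex.ofReal_sub, ← Complex.ofReal_pow, Complex.re_mul_ofReal]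
    simp
  set R : ℝ → ℂ := fun t => a2 t / ((t : ℂ) - t0) ^ 2 - 3 * a1 t / ((t : ℂ) - t0) ^ 3
    + 3 * a t / ((t : ℂ) - t0) ^ 4 with hR
  set H : ℝ → ℂ := fun t => E t * (α * (a t / ((t : ℂ) - t0)) -
    α ^ 2 * (a1 t / ((t : ℂ) - t0) ^ 2 - a t / ((t : ℂ) - t0) ^ 3)) with hH
  have hdu : ∀ t : ℝ, HasDerivAt (fun t : ℝ => (t : ℂ) - t0) 1 t := fun t =>
    (Complex.ofRealCLM.hasDerivAt (x := t)).sub_const _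
  have hdE : ∀ t : ℝ, HasDerivAt E (E t * (α⁻¹ * ((t : ℂ) - t0))) t := by
    intro t
    have h1 := (((hdu t).pow 2).const_mul (2 * π * Complex.I * l)).cexp
    have h2 : HasDerivAt E _ t := h1
    convert h2 using 1
    rw [hα, inv_inv, hE]
    simp
    ring
  have hdH : ∀ t ∈ Set.Icc (3/8 : ℝ) 3, HasDerivAt H (a t * E t - α ^ 2 * (E t * R t)) t := by
    intro t ht
    have hne := hune t ht
    have h1 := (hd0 t).div (hdu t) hne
    have h2 := (hd1 t).div ((hdu t).pow 2) (pow_ne_zero 2 hne)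
    have h3 := (hd0 t).div ((hdu t).pow 3) (pow_ne_zero 3 hne)
    have h4 := (hdE t).mul ((h1.const_mul α).sub ((h2.sub h3).const_mul (α ^ 2)))
    have h5 : HasDerivAt H _ t := h4
    convert h5 using 1
    simp only [hR, Pi.sub_apply, Pi.div_apply, Pi.pow_apply]
    field_simp
    ring
  have hEc : Continuous E := by rw [hE]; fun_prop
  have hRc : ContinuousOn R (Set.Icc (3/8 : ℝ) 3) := by
    have := ha.continuous
    have := hc1.continuous
    have := hc2.continuous
    have hk : ∀ k : ℕ, ∀ t ∈ Set.Icc (3/8 : ℝ) 3, ((t : ℂ) - t0) ^ k ≠ 0 := fun k t ht =>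
      pow_ne_zero k (hune t ht)
    rw [hR]
    refine ((ContinuousOn.div ?_ ?_ (hk 2)).sub (ContinuousOn.div ?_ ?_ (hk 3))).add
      (ContinuousOn.div ?_ ?_ (hk 4)) <;> fun_prop
  have huIcc : Set.uIcc (3/8 : ℝ) 3 = Set.Icc (3/8 : ℝ) 3 := Set.uIcc_of_le (by norm_num)
  have hi1 : IntervalIntegrable (fun t => a t * E t) volume (3/8) 3 :=
    (ha.continuous.mul hEc).intervalIntegrable _ _
  have hi2 : IntervalIntegrable (fun t => α ^ 2 * (E t * R t)) volume (3/8) 3 := by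
    refine ContinuousOn.intervalIntegrable ?_
    rw [huIcc]
    exact continuousOn_const.mul (hEc.continuousOn.mul hRc)
  have hftc := intervalIntegral.integral_eq_sub_of_hasDerivAt
    (fun t ht => hdH t (huIcc ▸ ht)) (hi1.sub hi2)
  have hH1 : H 3 = 0 := by
    have e0 := hz0 3 (by norm_num)
    have e1 := hz1 3 (by norm_num)
    simp [hH, e0, e1]
  have hH2 : H (3/8) = 0 := by
    have e0 := hz0 (3/8) (by norm_num)
    have e1 := hz1 (3/8) (by norm_num)
    simp only [hH, e0, e1]
    simp
  rw [hH1, hH2, intervalIntegral.integral_sub hi1 hi2, sub_zero, sub_eq_zero] at hftc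
  have hfull : ∫ t : ℝ, a t * E t = ∫ t in (3/8 : ℝ)..3, a t * E t := by
    symm
    refine intervalIntegral.integral_eq_integral_of_support_subset ?_
    intro t ht
    by_contra hcon
    apply ht
    simp only
    rw [hz0 t, zero_mul]
    intro h
    apply hcon
    constructor <;> linarith [h.1, h.2]
  change ‖∫ t : ℝ, a t * E t‖ ≤ _
  rw [hfull, hftc]
  have hbd : ∀ t ∈ Set.uIoc (3/8 : ℝ) 3, ‖α ^ 2 * (E t * R t)‖ ≤ 217 * 16 * B * ((l * t0) ^ 2)⁻¹ := by
    intro t ht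
    have ht' : t ∈ Set.Icc (3/8 : ℝ) 3 := by
      rw [Set.uIoc_of_le (by norm_num)] at ht
      exact ⟨ht.1.le, ht.2⟩
    obtain ⟨hu1, hu2⟩ := hu t ht'
    have hnu : ‖(t : ℂ) - t0‖ = |t - t0| := by
      rw [← Complex.ofReal_sub, Complex.norm_real, Real.norm_eq_abs]
    set v := |t - t0|⁻¹ with hv
    have hv0 : 0 ≤ v := by positivity
    have hv8 : v ≤ 8 := by
      rw [hv, inv_le_comm₀ (by linarith) (by norm_num)]; linarith
    have hvt : v ≤ 4 * |t0|⁻¹ := by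
      have h0 : 0 < |t0| := abs_pos.2 ht0
      have := inv_anti₀ (by positivity) hu2
      rw [hv]
      refine this.trans (le_of_eq ?_)
      field_simp
    have hRn : ‖R t‖ ≤ 217 * B * v ^ 2 := by
      have n1 : ‖a2 t / ((t : ℂ) - t0) ^ 2‖ ≤ B * v ^ 2 := by
        rw [norm_div, norm_pow, hnu, div_eq_mul_inv, ← inv_pow]
        exact mul_le_mul_of_nonneg_right (hb2 t) (by positivity)
      have n2 : ‖3 * a1 t / ((t : ℂ) - t0) ^ 3‖ ≤ 3 * B * v ^ 3 := by
        rw [norm_div, norm_pow, hnu, div_eq_mul_inv, ← inv_pow, norm_mul]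
        refine mul_le_mul_of_nonneg_right ?_ (by positivity)
        have := hb1 t
        simp; linarith
      have n3 : ‖3 * a t / ((t : ℂ) - t0) ^ 4‖ ≤ 3 * B * v ^ 4 := by
        rw [norm_div, norm_pow, hnu, div_eq_mul_inv, ← inv_pow, norm_mul]
        refine mul_le_mul_of_nonneg_right ?_ (by positivity)
        have := hb0 t
        simp; linarith
      have n4 : 3 * B * v ^ 3 ≤ 24 * B * v ^ 2 := by
        have : 0 ≤ 3 * B * v ^ 2 := by positivity
        nlinarith
      have n5 : 3 * B * v ^ 4 ≤ 192 * B * v ^ 2 := by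
        have h1 : 0 ≤ 3 * B * v ^ 2 := by positivity
        have h2 : v ^ 2 ≤ 64 := by nlinarith
        nlinarith
      calc ‖R t‖ ≤ ‖a2 t / ((t : ℂ) - t0) ^ 2‖ + ‖3 * a1 t / ((t : ℂ) - t0) ^ 3‖ +
          ‖3 * a t / ((t : ℂ) - t0) ^ 4‖ :=
            (norm_add_le _ _).trans (add_le_add_left (norm_sub_le _ _) _)
        _ ≤ _ := by linarith
    rw [norm_mul, norm_mul, hEn, one_mul, norm_pow]
    calc ‖α‖ ^ 2 * ‖R t‖ ≤ (l⁻¹) ^ 2 * (217 * B * v ^ 2) := by gcongr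
      _ ≤ (l⁻¹) ^ 2 * (217 * B * (4 * |t0|⁻¹) ^ 2) := by gcongr
      _ = _ := by
        rw [mul_pow 4, inv_pow |t0|, sq_abs]
        rw [mul_pow l, mul_inv]
        ring
  refine (intervalIntegral.norm_integral_le_of_norm_le_const hbd).trans ?_
  rw [abs_of_pos (by norm_num)]
  have : 0 ≤ B * ((l * t0) ^ 2)⁻¹ := by positivity
  nlinarith

lemma core_bound (a : ℝ → ℂ) (ha : ContDiff ℝ (⊤ : ℕ∞) a) (hsupp : tsupport a ⊆ Set.Icc (1/2 : ℝ) 2) :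
    ∃ K : ℝ, 0 ≤ K ∧ ∀ l : ℝ, 0 < l → ∀ t0 : ℝ, 1 ≤ 2 * l * |t0| →
    ‖(∫ t : ℝ, a t * Complex.exp (2 * π * Complex.I * l * ((t : ℂ) - t0) ^ 2)) -
      (((2 * l) ^ (-(1/2) : ℝ) : ℝ) : ℂ) * Complex.exp (Complex.I * π / 4) * a t0‖
      ≤ K * (2 * l * |t0|) ^ (-(3/2) : ℝ) := by
  have hcs : HasCompactSupport a := HasCompactSupport.of_support_subset_isCompact isCompact_Icc
    ((subset_tsupport a).trans hsupp)
  obtain ⟨K1, hK1, H1⟩ := nonstat a ha hsupp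
  obtain ⟨K2, hK2, H2⟩ := stat_real (hcs.toSchwartzMap ha)
  refine ⟨4 * K1 + 8 * K2, by positivity, ?_⟩
  intro l hl t0 hw
  have ht0 : t0 ≠ 0 := by
    rintro rfl; norm_num at hw
  have hw0 : 0 < 2 * l * |t0| := by linarith
  set w := 2 * l * |t0| with hwdef
  have hwp : 0 ≤ w ^ (-(3/2) : ℝ) := Real.rpow_nonneg hw0.le _
  by_cases hin : t0 ∈ Set.Icc (1/4 : ℝ) 4
  · have h2 := H2 l hl t0
    simp only [HasCompactSupport.toSchwartzMap_toFun] at h2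
    refine h2.trans ?_
    have e1 : (2 * l) ^ (-(3/2) : ℝ) ≤ 8 * w ^ (-(3/2) : ℝ) := by
      have hp : 0 < t0 := by linarith [hin.1]
      have e2 : w ^ (-(3/2) : ℝ) = (2 * l) ^ (-(3/2) : ℝ) * t0 ^ (-(3/2) : ℝ) := by
        rw [hwdef, abs_of_pos hp, Real.mul_rpow (by positivity) hp.le]
      have e3 : (1/8 : ℝ) ≤ t0 ^ (-(3/2) : ℝ) := by
        have : (4 : ℝ) ^ (-(3/2) : ℝ) = 1/8 := by
          rw [show (4:ℝ) = 2 ^ (2:ℝ) by norm_num, ← Real.rpow_mul (by norm_num)]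
          norm_num
        rw [← this]
        exact Real.rpow_le_rpow_of_nonpos hp hin.2 (by norm_num)
      have e4 : 0 ≤ (2 * l) ^ (-(3/2) : ℝ) := by positivity
      rw [e2]
      nlinarith
    calc K2 * (2 * l) ^ (-(3/2) : ℝ) ≤ K2 * (8 * w ^ (-(3/2) : ℝ)) := by gcongr
      _ ≤ _ := by nlinarith
  · have hz : a t0 = 0 := by
      refine image_eq_zero_of_notMem_tsupport fun h => hin ?_
      have := hsupp h
      constructor <;> linarith [this.1, this.2]
    rw [hz, mul_zero, sub_zero]
    refine (H1 l hl t0 ht0 hin).trans ?_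
    have e1 : ((l * t0) ^ 2)⁻¹ = 4 * w ^ (-2 : ℝ) := by
      rw [show (-2 : ℝ) = ((-2 : ℤ) : ℝ) by norm_num, Real.rpow_intCast, hwdef, zpow_neg,
        zpow_ofNat, mul_pow, mul_pow, sq_abs, mul_pow]
      field_simp
      norm_num
    have e2 : w ^ (-2 : ℝ) ≤ w ^ (-(3/2) : ℝ) :=
      Real.rpow_le_rpow_of_exponent_le hw (by norm_num)
    rw [e1]
    calc K1 * (4 * w ^ (-2 : ℝ)) ≤ K1 * (4 * w ^ (-(3/2) : ℝ)) := by gcongr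
      _ ≤ _ := by nlinarith

lemma tsum_int_pos (f : ℤ → ℂ) (hf : ∀ m ≤ 0, f m = 0) :
    ∑' m : ℤ, f m = ∑' n : ℕ, f ((n : ℤ) + 1) := by
  have hinj : Function.Injective (fun n : ℕ => (n : ℤ) + 1) := by
    intro a b h
    simp only at h
    omega
  rw [← hinj.tsum_eq]
  intro m hm
  have : 0 < m := by
    by_contra hcon
    exact hm (hf m (by omega))
  exact ⟨(m - 1).toNat, by simp only; omega⟩

open scoped SchwartzMap in
lemma schwartz_summable (g : 𝓢(ℝ, ℂ)) : Summable fun n : ℤ => g n :=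
  summable_of_isBigO (Real.summable_abs_int_rpow one_lt_two)
    ((g.isBigO_cocompact_rpow (-2)).comp_tendsto Int.tendsto_coe_cofinite)

open scoped SchwartzMap FourierTransform in
lemma poisson_gauss (A : ℝ → ℂ) (hA : ContDiff ℝ (⊤ : ℕ∞) A) (hcs : HasCompactSupport A)
    (p : ℤ) (q : ℕ) (hq : 1 ≤ q) (N : ℕ) (hN : 1 ≤ N) :
    (Summable fun m : ℤ => gaussTau p q m *
      ∫ t : ℝ, A t * Complex.exp (-(2 * π * Complex.I * m * (N / q) * t))) ∧
    ∑' n : ℤ, Complex.exp (2 * π * Complex.I * p * n ^ 2 / q) * A ((n : ℝ) / N) =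
      (N / q : ℂ) * ∑' m : ℤ, gaussTau p q m *
        ∫ t : ℝ, A t * Complex.exp (-(2 * π * Complex.I * m * (N / q) * t)) := by
  have : NeZero q := ⟨by omega⟩
  have hq0 : (0 : ℝ) < q := by exact_mod_cast hq
  have hN0 : (0 : ℝ) < N := by exact_mod_cast hN
  have hqC : (q : ℂ) ≠ 0 := by exact_mod_cast hq0.ne'
  have hNC : (N : ℂ) ≠ 0 := by exact_mod_cast hN0.ne'
  have hc : (q / N : ℝ) ≠ 0 := by positivity
  have hc' : (1 / N : ℝ) ≠ 0 := by positivity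
  set f : 𝓢(ℝ, ℂ) := (hcs.comp_homeomorph (Homeomorph.mulLeft₀ (q / N : ℝ) hc)).toSchwartzMap
    (hA.comp (contDiff_const.mul contDiff_id)) with hf
  set f' : 𝓢(ℝ, ℂ) := (hcs.comp_homeomorph (Homeomorph.mulLeft₀ (1 / N : ℝ) hc')).toSchwartzMap
    (hA.comp (contDiff_const.mul contDiff_id)) with hf'
  have hfa : ∀ y, f y = A (q / N * y) := fun y => rfl
  have hfa' : ∀ y, f' y = A (1 / N * y) := fun y => rfl
  set J : ℤ → ℂ := fun m => ∫ t : ℝ, A t * Complex.exp (-(2 * π * Complex.I * m * (N / q) * t)) with hJ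
  have hFf : ∀ m : ℤ, (𝓕 f) (m : ℝ) = (N / q : ℂ) * J m := by
    intro m
    rw [SchwartzMap.fourier_coe, Real.fourier_real_eq_integral_exp_smul]
    have h1 := MeasureTheory.Measure.integral_comp_mul_left
      (fun t : ℝ => A t * Complex.exp (-(2 * π * Complex.I * m * (N / q) * t))) (q / N : ℝ)
    rw [abs_of_pos (by positivity)] at h1
    have h2 : (((q / N : ℝ)⁻¹ : ℝ)) • J m = (N / q : ℂ) * J m := by
      rw [Complex.real_smul]
      congr 1
      push_cast
      field_simp
    rw [← h2, hJ]
    simp only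
    rw [← h1]
    congr 1
    ext y
    rw [hfa, smul_eq_mul, mul_comm]
    congr 2
    push_cast
    field_simp
  have hsF : Summable fun m : ℤ => (𝓕 f) (m : ℝ) := schwartz_summable (𝓕 f)
  set w : ℤ → ℂ := fun n => Complex.exp (2 * π * Complex.I * p * n ^ 2 / q) * A ((n : ℝ) / N) with hw
  have hen : ∀ n : ℤ, ‖Complex.exp (2 * π * Complex.I * p * n ^ 2 / q)‖ = 1 := by
    intro n
    have : (2 * π * Complex.I * p * n ^ 2 / q : ℂ) = ((2 * π * p * n ^ 2 / q : ℝ) : ℂ) * Complex.I := by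
      push_cast; ring
    rw [this, Complex.norm_exp_ofReal_mul_I]
  have hsw : Summable w := by
    refine Summable.of_norm ?_
    have h1 := (schwartz_summable f').norm
    refine h1.congr fun n => ?_
    rw [hw]
    simp only
    rw [norm_mul, hen, one_mul, hfa']
    congr 2
    ring
  have hτ : ∀ m : ℤ, gaussTau p q m = ∑ b : Fin q,
      Complex.exp (2 * π * Complex.I * p * (b : ℕ) ^ 2 / q) *
        fourier m (((b : ℕ) / q : ℝ) : UnitAddCircle) := by
    intro m
    rw [gaussTau, Finset.sum_range]
    refine Finset.sum_congr rfl fun b _ => ?_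
    rw [fourier_coe_apply, ← Complex.exp_add]
    congr 1
    push_cast
    field_simp
  have hterm : ∀ b : Fin q, Summable fun m : ℤ =>
      Complex.exp (2 * π * Complex.I * p * (b : ℕ) ^ 2 / q) *
        ((𝓕 f) (m : ℝ) * fourier m (((b : ℕ) / q : ℝ) : UnitAddCircle)) := by
    intro b
    refine Summable.mul_left _ ?_
    refine Summable.of_norm ?_
    refine hsF.norm.congr fun m => ?_
    rw [norm_mul, fourier_apply, Circle.norm_coe, mul_one]
  have hsumeq : (fun m : ℤ => ∑ b : Fin q, Complex.exp (2 * π * Complex.I * p * (b : ℕ) ^ 2 / q) *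
        ((𝓕 f) (m : ℝ) * fourier m (((b : ℕ) / q : ℝ) : UnitAddCircle))) =
      fun m : ℤ => (N / q : ℂ) * (gaussTau p q m * J m) := by
    funext m
    rw [hτ, hFf, Finset.sum_mul, Finset.mul_sum]
    refine Finset.sum_congr rfl fun b _ => ?_
    ring
  have hS : Summable fun m : ℤ => (N / q : ℂ) * (gaussTau p q m * J m) := by
    rw [← hsumeq]
    exact summable_sum fun b _ => hterm b
  refine ⟨?_, ?_⟩
  · refine (summable_mul_left_iff (a := (N / q : ℂ)) (div_ne_zero hNC hqC)).1 hS
  · rw [← tsum_mul_left, ← hsumeq, Summable.tsum_finsetSum (fun b _ => hterm b)]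
    have hsw2 : Summable (w ∘ ((Equiv.prodComm (Fin q) ℤ).trans (Int.divModEquiv q).symm)) :=
      (Equiv.summable_iff _).2 hsw
    rw [← Equiv.tsum_eq ((Equiv.prodComm (Fin q) ℤ).trans (Int.divModEquiv q).symm) w]
    have hprod := hsw2.tsum_prod
    simp only [Function.comp_apply] at hprod
    rw [hprod, tsum_fintype]
    refine Finset.sum_congr rfl fun b _ => ?_
    rw [tsum_mul_left, ← SchwartzMap.tsum_eq_tsum_fourier, ← tsum_mul_left]
    refine tsum_congr fun k => ?_
    simp only [Equiv.trans_apply, Equiv.prodComm_apply, Prod.swap_prod_mk,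
      Int.divModEquiv_symm_apply, hw]
    rw [hfa]
    congr 1
    · rw [Complex.exp_eq_exp_iff_exists_int]
      refine ⟨p * (k ^ 2 * q + 2 * k * (b : ℕ)), ?_⟩
      push_cast
      field_simp
      ring
    · congr 1
      push_cast
      field_simp
      ring

lemma amp_contDiff (s : ℝ) (φ : ℝ → ℂ) (hφ : ContDiff ℝ (⊤ : ℕ∞) φ)
    (hsupp : tsupport φ ⊆ Set.Icc (1/2 : ℝ) 2) :
    ContDiff ℝ (⊤ : ℕ∞) (fun t : ℝ => (((t ^ (-s) : ℝ)) : ℂ) * φ t) := by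
  rw [contDiff_iff_contDiffAt]
  intro t
  by_cases ht : t ∈ tsupport φ
  · have h0 : t ≠ 0 := by
      have := (hsupp ht).1
      intro h; rw [h] at this; norm_num at this
    refine ContDiffAt.mul ?_ hφ.contDiffAt
    exact Complex.ofRealCLM.contDiff.contDiffAt.comp t (Real.contDiffAt_rpow_const_of_ne h0)
  · have h1 : φ =ᶠ[nhds t] 0 := notMem_tsupport_iff_eventuallyEq.1 ht
    have h2 : (fun t : ℝ => (((t ^ (-s) : ℝ)) : ℂ) * φ t) =ᶠ[nhds t] fun _ => 0 := by
      filter_upwards [h1] with x hx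
      rw [hx]; simp
    exact contDiffAt_const.congr_of_eventuallyEq h2

lemma rpow_identity {s h q N μ : ℝ} (hh : 0 < h) (hq : 0 < q) (hN : 0 < N) (hμ : 0 < μ) :
    (2 * h * q) ^ (s - 1/2) * (μ ^ (-s) / Real.sqrt q) =
      N ^ (1 - s) / q * ((2 * (N ^ 2 * h)) ^ (-(1/2) : ℝ) * (μ / (2 * N * h * q)) ^ (-s)) := by
  have h2 : Real.log (2 * h * q) = Real.log 2 + Real.log h + Real.log q := by
    rw [Real.log_mul (by positivity) (by positivity), Real.log_mul (by positivity) (by positivity)]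
  have h3 : Real.log (2 * (N ^ 2 * h)) = Real.log 2 + 2 * Real.log N + Real.log h := by
    rw [Real.log_mul (by positivity) (by positivity), Real.log_mul (by positivity) (by positivity),
      Real.log_pow]
    push_cast; ring
  have h4 : Real.log (μ / (2 * N * h * q)) =
      Real.log μ - (Real.log 2 + Real.log N + Real.log h + Real.log q) := by
    rw [Real.log_div (by positivity) (by positivity), Real.log_mul (by positivity) (by positivity),
      Real.log_mul (by positivity) (by positivity), Real.log_mul (by positivity) (by positivity)]
  have h5 : Real.sqrt q = Real.exp (Real.log q * (1/2)) := by
    rw [Real.sqrt_eq_rpow, Real.rpow_def_of_pos hq]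
  have h6 : N ^ (1 - s) / q = Real.exp (Real.log N * (1 - s) - Real.log q) := by
    rw [Real.exp_sub, Real.exp_log hq, Real.rpow_def_of_pos hN]
  rw [h6, Real.rpow_def_of_pos (by positivity : 0 < 2 * h * q), Real.rpow_def_of_pos hμ,
    Real.rpow_def_of_pos (by positivity : 0 < 2 * (N ^ 2 * h)),
    Real.rpow_def_of_pos (by positivity : 0 < μ / (2 * N * h * q)), h2, h3, h4, h5, ← Real.exp_sub,
    ← Real.exp_add, ← Real.exp_add, ← Real.exp_add]
  congr 1
  ring

lemma rpow_identity_bound {s q N : ℝ} (hq : 0 < q) (hN : 0 < N) :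
    N ^ (1 - s) / q * (Real.sqrt q * (N / q) ^ (-(3/2) : ℝ)) = q * N ^ (-(1/2 : ℝ) - s) := by
  have h4 : Real.log (N / q) = Real.log N - Real.log q := Real.log_div hN.ne' hq.ne'
  have h5 : Real.sqrt q = Real.exp (Real.log q * (1/2)) := by
    rw [Real.sqrt_eq_rpow, Real.rpow_def_of_pos hq]
  have h6 : N ^ (1 - s) / q = Real.exp (Real.log N * (1 - s) - Real.log q) := by
    rw [Real.exp_sub, Real.exp_log hq, Real.rpow_def_of_pos hN]
  have h7 : q * N ^ (-(1/2 : ℝ) - s) = Real.exp (Real.log q + Real.log N * (-(1/2 : ℝ) - s)) := by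
    rw [Real.exp_add, Real.exp_log hq, Real.rpow_def_of_pos hN]
  rw [h6, h7, Real.rpow_def_of_pos (by positivity : 0 < N / q), h4, h5, ← Real.exp_add,
    ← Real.exp_add]
  congr 1
  ring

/-- summation formula for smooth pieces, Lemma 3.7. For `s ∈ (1/2,1]`
and a `C^∞` function `φ` supported in `[1/2,2]`, there is a constant `C > 0`, depending
only on `φ` and `s`, such that for all coprime `p, q` with `q ≥ 1`, all `N ≥ q` and all
`0 < h ≤ 1/q`:
`|F^φ_{s,N}(p/q + h) - (N^{1-s}θ_0/√q) ∫ t^{-s} e^{2πiN²ht²} φ(t) dt - G^φ_{s,N}(h)|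
  ≤ C q N^{-1/2-s}`. -/
theorem summation_formula_smooth (s : ℝ) (hs : s ∈ Set.Ioc (1/2 : ℝ) 1)
    (φ : ℝ → ℂ) (hφ : ContDiff ℝ (⊤ : ℕ∞) φ) (hsupp : tsupport φ ⊆ Set.Icc (1/2 : ℝ) 2) :
    ∃ C : ℝ, 0 < C ∧
      ∀ (p : ℤ) (q : ℕ), 1 ≤ q → IsCoprime p (q : ℤ) →
        ∀ N : ℕ, q ≤ N → ∀ h : ℝ, 0 < h → h ≤ 1 / q →
          ‖FphiN s φ N ((p : ℝ) / q + h) -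
              ((((N : ℝ) ^ (1 - s) : ℝ)) : ℂ) * gaussTheta p q 0 / (Real.sqrt q : ℂ) *
                (∫ t : ℝ, (((t ^ (-s) : ℝ)) : ℂ) *
                  Complex.exp (2 * Real.pi * Complex.I * (N : ℂ) ^ 2 * (h : ℂ) * (t : ℂ) ^ 2) * φ t) -
              GphiN s φ p q N h‖ ≤
            C * q * (N : ℝ) ^ (-(1/2 : ℝ) - s) := by
  set a : ℝ → ℂ := fun t : ℝ => (((t ^ (-s) : ℝ)) : ℂ) * φ t with ha
  have hac : ContDiff ℝ (⊤ : ℕ∞) a := amp_contDiff s φ hφ hsupp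
  have hasupp : tsupport a ⊆ Set.Icc (1/2 : ℝ) 2 :=
    (tsupport_mul_subset_right (f := fun t : ℝ => (((t ^ (-s) : ℝ)) : ℂ)) (g := φ)).trans hsupp
  have hacs : HasCompactSupport a := HasCompactSupport.of_support_subset_isCompact isCompact_Icc
    ((subset_tsupport a).trans hasupp)
  have haz : ∀ t ≤ 0, a t = 0 := by
    intro t ht
    refine image_eq_zero_of_notMem_tsupport fun h => ?_
    have := (hasupp h).1
    linarith
  obtain ⟨K, hK, hcore⟩ := core_bound a hac hasupp
  have hS0 : Summable fun m : ℤ => |(m : ℝ)| ^ (-(3/2) : ℝ) :=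
    Real.summable_abs_int_rpow (by norm_num)
  set S0 := ∑' m : ℤ, |(m : ℝ)| ^ (-(3/2) : ℝ) with hS0def
  have hS0n : 0 ≤ S0 := tsum_nonneg fun m => by positivity
  refine ⟨2 * K * S0 + 1, by positivity, ?_⟩
  intro p q hq hpq N hqN h hh _
  have hN : 1 ≤ N := hq.trans hqN
  have hq0 : (0 : ℝ) < q := by exact_mod_cast hq
  have hN0 : (0 : ℝ) < N := by exact_mod_cast hN
  have hqC : (q : ℂ) ≠ 0 := by exact_mod_cast hq0.ne'
  have hNC : (N : ℂ) ≠ 0 := by exact_mod_cast hN0.ne'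
  have hhC : (h : ℂ) ≠ 0 := by exact_mod_cast hh.ne'
  have hsq : (Real.sqrt q : ℂ) * (Real.sqrt q : ℂ) = q := by
    rw [← Complex.ofReal_mul, Real.mul_self_sqrt hq0.le]; simp
  have hsq0 : (Real.sqrt q : ℂ) ≠ 0 := by
    intro h0; rw [h0, mul_zero] at hsq; exact hqC hsq.symm
  set l : ℝ := (N : ℝ) ^ 2 * h with hl
  have hl0 : 0 < l := by positivity
  set A : ℝ → ℂ := fun t => a t * Complex.exp (2 * π * Complex.I * l * (t : ℂ) ^ 2) with hA
  have hAc : ContDiff ℝ (⊤ : ℕ∞) A := by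
    refine hac.mul ?_
    refine ContDiff.cexp ?_
    refine contDiff_const.mul (ContDiff.pow ?_ 2)
    exact Complex.ofRealCLM.contDiff
  have hAcs : HasCompactSupport A := hacs.mul_right
  obtain ⟨hsum, hpois⟩ := poisson_gauss A hAc hAcs p q hq N hN
  set J : ℤ → ℂ := fun m => ∫ t : ℝ, A t * Complex.exp (-(2 * π * Complex.I * m * (N / q) * t)) with hJ
  set T : ℤ → ℝ := fun m => (m : ℝ) / (2 * N * h * q) with hT
  set M : ℤ → ℂ := fun m => Complex.exp (-(2 * π * Complex.I * l * (T m : ℂ) ^ 2)) *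
    ((((2 * l) ^ (-(1/2) : ℝ) : ℝ) : ℂ) * Complex.exp (Complex.I * π / 4) * a (T m)) with hM
  have hMz : ∀ m ≤ 0, M m = 0 := by
    intro m hm
    have hm' : (m : ℝ) ≤ 0 := by exact_mod_cast hm
    have : a (T m) = 0 := haz _ (div_nonpos_of_nonpos_of_nonneg hm' (by positivity))
    rw [hM]; simp only; rw [this]; simp
  -- the error terms
  have hJT : ∀ m : ℤ, J m = Complex.exp (-(2 * π * Complex.I * l * (T m : ℂ) ^ 2)) *
      ∫ t : ℝ, a t * Complex.exp (2 * π * Complex.I * l * ((t : ℂ) - T m) ^ 2) := by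
    intro m
    rw [hJ, ← integral_const_mul]
    refine integral_congr_ae (Eventually.of_forall fun t => ?_)
    rw [hA]
    simp only
    rw [mul_assoc, ← Complex.exp_add, mul_left_comm, ← Complex.exp_add]
    congr 2
    rw [hT, hl]
    push_cast
    field_simp
    ring
  have hD : ∀ m : ℤ, m ≠ 0 → ‖J m - M m‖ ≤ K * ((N / q : ℝ) ^ (-(3/2) : ℝ) * |(m : ℝ)| ^ (-(3/2) : ℝ)) := by
    intro m hm
    have hw : 2 * l * |T m| = (N / q : ℝ) * |(m : ℝ)| := by
      rw [hT, hl]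
      simp only
      rw [abs_div, abs_of_pos (by positivity : 0 < 2 * N * h * q)]
      field_simp
    have hm1 : (1 : ℝ) ≤ |(m : ℝ)| := by
      exact_mod_cast Int.one_le_abs hm
    have hNq : (1 : ℝ) ≤ N / q := by
      rw [le_div_iff₀ hq0, one_mul]; exact_mod_cast hqN
    have h1 := hcore l hl0 (T m) (by rw [hw]; nlinarith)
    rw [hw, Real.mul_rpow (by positivity) (abs_nonneg _)] at h1
    have hEn : ‖Complex.exp (-(2 * π * Complex.I * l * (T m : ℂ) ^ 2))‖ = 1 := by
      have : (-(2 * π * Complex.I * l * (T m : ℂ) ^ 2) : ℂ) =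
          ((-(2 * π * l * (T m) ^ 2) : ℝ) : ℂ) * Complex.I := by
        push_cast; ring
      rw [this, Complex.norm_exp_ofReal_mul_I]
    rw [hJT, hM]
    simp only
    rw [← mul_sub, norm_mul, hEn, one_mul]
    exact h1
  set D : ℤ → ℂ := fun m => if m = 0 then 0 else gaussTau p q m * (J m - M m) with hDdef
  set c : ℝ := 2 * Real.sqrt q * (K * (N / q : ℝ) ^ (-(3/2) : ℝ)) with hc
  have hc0 : 0 ≤ c := by positivity
  have hDb : ∀ m, ‖D m‖ ≤ c * |(m : ℝ)| ^ (-(3/2) : ℝ) := by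
    intro m
    by_cases hm : m = 0
    · simp only [hDdef, hm, if_true, norm_zero]
      positivity
    · simp only [hDdef, hm, if_false]
      rw [norm_mul]
      calc _ ≤ (2 * Real.sqrt q) * (K * ((N / q : ℝ) ^ (-(3/2) : ℝ) * |(m : ℝ)| ^ (-(3/2) : ℝ))) :=
            mul_le_mul (gaussTau_norm_le p q hq hpq m) (hD m hm) (norm_nonneg _) (by positivity)
        _ = _ := by rw [hc]; ring
  have hDs : Summable D := Summable.of_norm_bounded (hS0.mul_left c) hDb
  have hDn : ‖∑' m, D m‖ ≤ c * S0 := tsum_of_norm_bounded (hS0.hasSum.mul_left c) hDb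
  have hM' : HasSum (fun m : ℤ => gaussTau p q m * M m)
      ((∑' m : ℤ, gaussTau p q m * J m) - (∑' m, D m) - gaussTau p q 0 * J 0) := by
    have h1 := (hsum.hasSum.sub hDs.hasSum).sub (hasSum_ite_eq (0 : ℤ) (gaussTau p q 0 * J 0))
    refine h1.congr_fun fun m => ?_
    by_cases hm : m = 0
    · subst hm
      have e0 : D 0 = 0 := by simp [hDdef]
      rw [hMz 0 le_rfl, e0, if_pos rfl, mul_zero, sub_zero]
      exact (sub_self _).symm
    · simp only [hDdef, hm, if_false]
      ring
  -- identify F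
  have hF : FphiN s φ N ((p : ℝ) / q + h) =
      ((((N : ℝ) ^ (1 - s) / q : ℝ)) : ℂ) * ∑' m : ℤ, gaussTau p q m * J m := by
    have e1 : ((((N : ℝ) ^ (1 - s) / q : ℝ)) : ℂ) = (((N : ℝ) ^ (-s) : ℝ) : ℂ) * (N / q : ℂ) := by
      rw [show (1 - s) = -s + 1 by ring, Real.rpow_add hN0, Real.rpow_one]
      push_cast; ring
    rw [e1, mul_assoc, ← hpois, tsum_int_pos, FphiN, ← tsum_mul_left]
    · refine tsum_congr fun n => ?_
      have e2 : ((n : ℝ) + 1) ^ (-s) = (N : ℝ) ^ (-s) * (((n : ℝ) + 1) / N) ^ (-s) := by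
        rw [← Real.mul_rpow hN0.le (by positivity)]
        congr 1
        field_simp
      have e3 : Complex.exp (2 * π * Complex.I * ((n : ℂ) + 1) ^ 2 * (((p : ℝ) / q + h : ℝ) : ℂ)) =
          Complex.exp (2 * π * Complex.I * p * ((n : ℂ) + 1) ^ 2 / q) *
          Complex.exp (2 * π * Complex.I * l * ((((n : ℝ) + 1) / N : ℝ) : ℂ) ^ 2) := by
        rw [← Complex.exp_add, hl]
        congr 1
        push_cast
        field_simp
      rw [e3, e2, hA, ha]
      simp only
      push_cast
      ring
    · intro m hm
      have hm' : (m : ℝ) ≤ 0 := by exact_mod_cast hm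
      have : a ((m : ℝ) / N) = 0 := haz _ (div_nonpos_of_nonpos_of_nonneg hm' hN0.le)
      rw [hA]; simp only; rw [this]; simp
  -- identify G
  have hG : GphiN s φ p q N h =
      ((((N : ℝ) ^ (1 - s) / q : ℝ)) : ℂ) * ∑' m : ℤ, gaussTau p q m * M m := by
    rw [tsum_int_pos _ (fun m hm => by rw [hMz m hm, mul_zero]), GphiN, ← tsum_mul_left,
      ← tsum_mul_left]
    refine tsum_congr fun n => ?_
    have e1 := congrArg (fun x : ℝ => (x : ℂ))
      (rpow_identity (s := s) (μ := (n : ℝ) + 1) hh hq0 hN0 (by positivity))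
    rw [Complex.ofReal_mul, Complex.ofReal_mul, Complex.ofReal_mul, Complex.ofReal_div] at e1
    have e2 : Complex.exp (-(Complex.I * π * ((n : ℂ) + 1) ^ 2 / (2 * (q : ℂ) ^ 2 * (h : ℂ)))) =
        Complex.exp (-(2 * π * Complex.I * l * (T ((n : ℤ) + 1) : ℂ) ^ 2)) := by
      congr 1
      rw [hT, hl]
      push_cast
      field_simp
    have e3 : T ((n : ℤ) + 1) = ((n : ℝ) + 1) / (2 * N * h * q) := by
      rw [hT]; push_cast; rfl
    rw [e2, hM, ha]
    simp only
    rw [e3, gaussTheta]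
    linear_combination (gaussTau p q (n + 1) * Complex.exp (Complex.I * π / 4) *
      Complex.exp (-(2 * π * Complex.I * l * (((((n : ℝ) + 1) / (2 * N * h * q) : ℝ)) : ℂ) ^ 2)) *
      φ (((n : ℝ) + 1) / (2 * N * h * q))) * e1
  -- identify the zero frequency
  have hZ : ((((N : ℝ) ^ (1 - s) : ℝ)) : ℂ) * gaussTheta p q 0 / (Real.sqrt q : ℂ) *
      (∫ t : ℝ, (((t ^ (-s) : ℝ)) : ℂ) *
        Complex.exp (2 * Real.pi * Complex.I * (N : ℂ) ^ 2 * (h : ℂ) * (t : ℂ) ^ 2) * φ t) =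
      ((((N : ℝ) ^ (1 - s) / q : ℝ)) : ℂ) * (gaussTau p q 0 * J 0) := by
    have e1 : (∫ t : ℝ, (((t ^ (-s) : ℝ)) : ℂ) *
        Complex.exp (2 * Real.pi * Complex.I * (N : ℂ) ^ 2 * (h : ℂ) * (t : ℂ) ^ 2) * φ t) = J 0 := by
      rw [hJ]
      congr 1
      ext t
      rw [hA, ha, hl]
      simp only
      push_cast
      simp
      ring_nf
    rw [e1, gaussTheta]
    rw [Complex.ofReal_div, Complex.ofReal_natCast, ← hsq]
    field_simp
  rw [hF, hG, hZ, hM'.tsum_eq]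
  have hfin : ((((N : ℝ) ^ (1 - s) / q : ℝ)) : ℂ) * (∑' m : ℤ, gaussTau p q m * J m) -
      ((((N : ℝ) ^ (1 - s) / q : ℝ)) : ℂ) * (gaussTau p q 0 * J 0) -
      ((((N : ℝ) ^ (1 - s) / q : ℝ)) : ℂ) * ((∑' m : ℤ, gaussTau p q m * J m) - (∑' m, D m) -
        gaussTau p q 0 * J 0) = ((((N : ℝ) ^ (1 - s) / q : ℝ)) : ℂ) * ∑' m, D m := by
    ring
  rw [hfin, norm_mul, Complex.norm_real, Real.norm_of_nonneg (by positivity)]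
  have hpos : 0 ≤ (q : ℝ) * (N : ℝ) ^ (-(1/2 : ℝ) - s) := by positivity
  calc (N : ℝ) ^ (1 - s) / q * ‖∑' m, D m‖ ≤ (N : ℝ) ^ (1 - s) / q * (c * S0) := by gcongr
    _ = 2 * K * S0 * ((N : ℝ) ^ (1 - s) / q * (Real.sqrt q * (N / q : ℝ) ^ (-(3/2) : ℝ))) := by
        rw [hc]; ring
    _ = 2 * K * S0 * (q * (N : ℝ) ^ (-(1/2 : ℝ) - s)) := by rw [rpow_identity_bound hq0 hN0]
    _ ≤ _ := by nlinarith
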